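/- Let α > 0, n > 0, M = 1, and Ω = (0,1). There is a constant C = C(n,α) > 0 such that for every u ∈ C³([0,1]) with mean 1, minimum δ ∈ (0,1/2) over [0,1], and u'(0) = u'(1) = 0, one has ∫₀¹ u(x)ⁿ |u'''(x)|^{α+1} dx ≥ (C / log^{α+1}(1/δ)) · min{δ^{n−1−2α}, 1}. -/

import Mathlib

open Set

lemma first_hit {f : ℝ → ℝ} (hf : Continuous f) {a b : ℝ} (hab : a ≤ b) (ha : f a < 0)
    (hb : 0 ≤ f b) : ∃ x ∈ Ioc a b, f x = 0 ∧ ∀ y ∈ Icc a x, f y ≤ 0 := by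
  have hc : IsCompact (Icc a b ∩ {x | 0 ≤ f x}) :=
    isCompact_Icc.inter_right (isClosed_le continuous_const hf)
  obtain ⟨x, ⟨⟨hx1, hx2⟩, hx3⟩, hx4⟩ := hc.exists_isLeast ⟨b, ⟨hab, le_rfl⟩, hb⟩
  simp only [mem_ofPred_eq] at hx3
  have hlt : ∀ y, a ≤ y → y < x → f y < 0 := by
    intro y h1 h2
    by_contra h
    have := hx4 ⟨⟨h1, (h2.trans_le hx2).le⟩, not_lt.mp h⟩
    linarith
  have hax : a < x := by
    rcases hx1.lt_or_eq with h | h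
    · exact h
    · subst h; linarith
  have h0 : f x = 0 := by
    by_contra h
    have hpos : 0 < f x := lt_of_le_of_ne hx3 (Ne.symm h)
    obtain ⟨y, hy, hy0⟩ := intermediate_value_Icc hx1 hf.continuousOn ⟨ha.le, hx3⟩
    rcases hy.2.lt_or_eq with h' | h'
    · have := hlt y hy.1 h'; linarith
    · subst h'; exact h hy0
  refine ⟨x, ⟨hax, hx2⟩, h0, fun y hy => ?_⟩
  rcases hy.2.lt_or_eq with h' | h'
  · exact (hlt y hy.1 h').le
  · rw [h', h0]

/-- Hamiltonian point lemma. -/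
lemma ham_point {u u1 u2 : ℝ → ℝ} (h1 : ∀ x, HasDerivAt u (u1 x) x)
    (h2 : ∀ x, HasDerivAt u1 (u2 x) x) {δ m M : ℝ} (hδ : 0 < δ) (hδ2 : δ < 1 / 2)
    (hm0 : 0 ≤ m) (hmM : m < M) (hM1 : M ≤ 1) (hmin : ∀ x ∈ Icc (0:ℝ) 1, δ ≤ u x)
    (hum : u m = δ) (hu1m : u1 m = 0) (huM : 1 ≤ u M) :
    ∃ x ∈ Icc (0:ℝ) 1, u x ≤ 1 ∧ 1 / 4 ≤ u1 x ∧
      3 / (32 * Real.log (1 / δ)) / u x ≤ u2 x := by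
  have cu : Continuous u := continuous_iff_continuousAt.2 fun x => (h1 x).continuousAt
  have cu1 : Continuous u1 := continuous_iff_continuousAt.2 fun x => (h2 x).continuousAt
  have hL : 0 < Real.log (1 / δ) := Real.log_pos (by rw [lt_div_iff₀ hδ]; linarith)
  set L := Real.log (1 / δ) with hLdef
  obtain ⟨N, hN, huN, hN2⟩ := first_hit (f := fun x => u x - 1) (by fun_prop) hmM.le
    (by simp only [hum]; linarith) (by linarith)
  obtain ⟨y, hy, hys⟩ := exists_hasDerivAt_eq_slope u u1 hN.1 cu.continuousOn (fun x _ => h1 x)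
  have hy1 : 1 / 2 ≤ u1 y := by
    rw [hys, le_div_iff₀ (by linarith [hN.1])]
    have : N - m ≤ 1 := by linarith [hN.2]
    linarith
  obtain ⟨t, ht, hut, ht2⟩ := first_hit (f := fun x => 1 / 4 - u1 (-x)) (a := -y) (b := -m)
    (by fun_prop) (by linarith [hy.1]) (by simp only [neg_neg]; linarith) (by simp only [neg_neg, hu1m]; norm_num)
  obtain ⟨a, rfl⟩ : ∃ a, t = -a := ⟨-t, by ring⟩
  have hay : a < y := by linarith [ht.1]
  have hma : m ≤ a := by linarith [ht.2]
  simp only [neg_neg] at hut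
  have hq : ∀ x ∈ Icc a y, 1 / 4 ≤ u1 x := by
    intro x hx
    have := ht2 (-x) ⟨by linarith [hx.2], by linarith [hx.1]⟩
    simp only [neg_neg] at this
    linarith
  have hI : ∀ x ∈ Icc a y, x ∈ Icc (0:ℝ) 1 := fun x hx =>
    ⟨by linarith [hx.1], by linarith [hx.2, hy.2, hN.2]⟩
  have hpos : ∀ x ∈ Icc a y, 0 < u x := fun x hx => hδ.trans_le (hmin x (hI x hx))
  have hle : ∀ x ∈ Icc a y, u x ≤ 1 := by
    intro x hx
    have := hN2 x ⟨by linarith [hx.1], by linarith [hx.2, hy.2]⟩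
    linarith
  set κ := 3 / (32 * L) with hκ
  have hκL : κ * L = 3 / 32 := by rw [hκ]; field_simp
  have hκ0 : 0 < κ := by positivity
  have hd : ∀ x ∈ Icc a y, HasDerivAt (fun x => u1 x ^ 2 / 2 - κ * Real.log (u x))
      (u1 x * u2 x - κ * (u1 x / u x)) x := by
    intro x hx
    have e1 := ((h2 x).pow 2).div_const 2
    have e2 := ((h1 x).log (hpos x hx).ne').const_mul κ
    refine (e1.sub e2).congr_deriv ?_
    simp only [Nat.cast_ofNat]
    ring
  obtain ⟨ξ, hξ, hs⟩ := exists_hasDerivAt_eq_slope _ _ hay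
    (fun x hx => (hd x hx).continuousAt.continuousWithinAt) (fun x hx => hd x (Ioo_subset_Icc_self hx))
  have hξ' := Ioo_subset_Icc_self hξ
  refine ⟨ξ, hI ξ hξ', hle ξ hξ', hq ξ hξ', ?_⟩
  have l1 : Real.log (u y) ≤ 0 :=
    Real.log_nonpos (hpos y ⟨hay.le, le_rfl⟩).le (hle y ⟨hay.le, le_rfl⟩)
  have l2 : -L ≤ Real.log (u a) := by
    rw [hLdef, one_div, Real.log_inv, neg_neg]
    exact Real.log_le_log hδ (hmin a (hI a ⟨le_rfl, hay.le⟩))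
  have hnum : 0 ≤ u1 ξ * u2 ξ - κ * (u1 ξ / u ξ) := by
    rw [hs]
    apply div_nonneg _ (by linarith)
    have ha4 : u1 a = 1 / 4 := by linarith
    rw [ha4]
    have : κ * (Real.log (u y) - Real.log (u a)) ≤ κ * L := by gcongr; linarith
    nlinarith
  have hu1p : 0 < u1 ξ := by linarith [hq ξ hξ']
  have : 0 ≤ u1 ξ * (u2 ξ - κ / u ξ) := by
    have : u1 ξ * (u2 ξ - κ / u ξ) = u1 ξ * u2 ξ - κ * (u1 ξ / u ξ) := by ring
    linarith
  have := nonneg_of_mul_nonneg_right this hu1p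
  linarith

open MeasureTheory in
lemma memLp_aux {f : ℝ → ℝ} {a b : ℝ} (hf : ContinuousOn f (Icc a b)) (p : ENNReal) :
    MemLp f p (volume.restrict (Ioc a b)) := by
  obtain ⟨C, hC⟩ := isCompact_Icc.exists_bound_of_continuousOn hf
  refine MemLp.of_bound ((hf.mono Ioc_subset_Icc_self).aestronglyMeasurable measurableSet_Ioc) C ?_
  filter_upwards [ae_restrict_mem measurableSet_Ioc] with x hx
  exact hC x (Ioc_subset_Icc_self hx)

lemma holder_aux {n α : ℝ} (hα : 0 < α) {u w : ℝ → ℝ} {a b : ℝ} (hab : a ≤ b)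
    (hu : ContinuousOn u (Icc a b)) (hw : ContinuousOn w (Icc a b))
    (hpos : ∀ x ∈ Icc a b, 0 < u x) :
    (∫ x in a..b, |w x|) ^ (α + 1) ≤
      (∫ x in a..b, u x ^ n * |w x| ^ (α + 1)) * (∫ x in a..b, u x ^ (-(n / α))) ^ α := by
  have hpq : (α + 1).HolderConjugate ((α + 1) / α) := by
    rw [Real.holderConjugate_iff]
    refine ⟨by linarith, ?_⟩
    field_simp
    ring
  have hf : ContinuousOn (fun x => u x ^ (n / (α + 1)) * |w x|) (Icc a b) :=
    (hu.rpow_const fun x hx => Or.inl (hpos x hx).ne').mul hw.abs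
  have hg : ContinuousOn (fun x => u x ^ (-(n / (α + 1)))) (Icc a b) :=
    (hu.rpow_const fun x hx => Or.inl (hpos x hx).ne')
  have hae : ∀ᵐ x ∂(MeasureTheory.volume.restrict (Ioc a b)), 0 < u x := by
    filter_upwards [MeasureTheory.ae_restrict_mem measurableSet_Ioc] with x hx
    exact hpos x (Ioc_subset_Icc_self hx)
  have key := MeasureTheory.integral_mul_le_Lp_mul_Lq_of_nonneg hpq
    (by filter_upwards [hae] with x hx; simp only [Pi.zero_apply]; positivity)
    (by filter_upwards [hae] with x hx; simp only [Pi.zero_apply]; positivity)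
    (memLp_aux hf _) (memLp_aux hg _)
  rw [MeasureTheory.integral_congr_ae (g := fun x => |w x|), MeasureTheory.integral_congr_ae
    (f := fun x => (u x ^ (n / (α + 1)) * |w x|) ^ (α + 1))
    (g := fun x => u x ^ n * |w x| ^ (α + 1)), MeasureTheory.integral_congr_ae
    (f := fun x => (u x ^ (-(n / (α + 1)))) ^ ((α + 1) / α))
    (g := fun x => u x ^ (-(n / α)))] at key
  rotate_left
  · filter_upwards [hae] with x hx
    rw [← Real.rpow_mul hx.le]
    congr 1
    field_simp
  · filter_upwards [hae] with x hx
    rw [Real.mul_rpow (by positivity) (by positivity), ← Real.rpow_mul hx.le]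
    congr 2
    field_simp
  · filter_upwards [hae] with x hx
    rw [mul_right_comm, ← Real.rpow_add hx]
    simp
  rw [← intervalIntegral.integral_of_le hab, ← intervalIntegral.integral_of_le hab,
    ← intervalIntegral.integral_of_le hab] at key
  have hA : 0 ≤ ∫ x in a..b, |w x| := intervalIntegral.integral_nonneg hab fun x _ => abs_nonneg _
  have hD : 0 ≤ ∫ x in a..b, u x ^ n * |w x| ^ (α + 1) :=
    intervalIntegral.integral_nonneg hab fun x hx => by have := hpos x hx; positivity
  have hJ : 0 ≤ ∫ x in a..b, u x ^ (-(n / α)) :=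
    intervalIntegral.integral_nonneg hab fun x hx => by have := hpos x hx; positivity
  have := Real.rpow_le_rpow hA key (by linarith : 0 ≤ α + 1)
  refine this.trans_eq ?_
  rw [Real.mul_rpow (by positivity) (by positivity), ← Real.rpow_mul hD, ← Real.rpow_mul hJ]
  congr 1
  · rw [one_div_mul_cancel (by positivity), Real.rpow_one]
  · congr 1
    field_simp

/-- bound for the weight integral -/
lemma weight_aux {n α : ℝ} (hn : 0 < n) (hα : 0 < α) : ∃ K : ℝ, 0 < K ∧
    ∀ (u u1 : ℝ → ℝ) (a b δ : ℝ), 0 ≤ a → a ≤ b → b ≤ 1 → 0 < δ → δ ≤ u a → u a ≤ 1 →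
    (∀ x, HasDerivAt u (u1 x) x) → Continuous u1 → (∀ x ∈ Icc a b, 1 / 4 ≤ u1 x) →
    (∫ x in a..b, u x ^ (-(n / α))) ^ α * min (δ ^ (n - 1 - 2 * α)) 1 ≤
      K * (1 / u a) ^ (α + 1) := by
  have common : ∀ (u u1 : ℝ → ℝ) (a b : ℝ), a ≤ b → 0 < u a →
      (∀ x, HasDerivAt u (u1 x) x) → (∀ x ∈ Icc a b, 1 / 4 ≤ u1 x) →
      ∀ x ∈ Icc a b, u a ≤ u x := by
    intro u u1 a b hab hpos h1 hq x hx
    have : MonotoneOn u (Icc a b) := by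
      apply monotoneOn_of_deriv_nonneg (convex_Icc a b)
      · exact fun x _ => (h1 x).continuousAt.continuousWithinAt
      · exact fun x _ => (h1 x).differentiableAt.differentiableWithinAt
      · intro x hx
        rw [(h1 x).deriv]
        have := hq x (interior_subset hx)
        linarith
    exact this ⟨le_rfl, hab⟩ hx hx.1
  rcases le_or_gt n α with hna | hna
  · refine ⟨1, one_pos, ?_⟩
    intro u u1 a b δ ha hab hb hδ hδu hu1 h1 c1 hq
    have hua : 0 < u a := hδ.trans_le hδu
    have hmono := common u u1 a b hab hua h1 hq
    have hpos : ∀ x ∈ Icc a b, 0 < u x := fun x hx => hua.trans_le (hmono x hx)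
    have cu : ContinuousOn u (Icc a b) := fun x _ => (h1 x).continuousAt.continuousWithinAt
    have cf : ContinuousOn (fun x => u x ^ (-(n / α))) (Icc a b) :=
      cu.rpow_const fun x hx => Or.inl (hpos x hx).ne'
    have hJ : 0 ≤ ∫ x in a..b, u x ^ (-(n / α)) :=
      intervalIntegral.integral_nonneg hab fun x hx => by have := hpos x hx; positivity
    have hI : (∫ x in a..b, u x ^ (-(n / α))) ≤ u a ^ (-(n / α)) := by
      calc _ ≤ ∫ x in a..b, u a ^ (-(n / α)) := by
            apply intervalIntegral.integral_mono_on hab (cf.intervalIntegrable_of_Icc hab)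
              intervalIntegrable_const
            intro x hx
            exact Real.rpow_le_rpow_of_nonpos hua (hmono x hx) (by
              have : 0 < n / α := by positivity
              linarith)
        _ = (b - a) * u a ^ (-(n / α)) := by simp
        _ ≤ 1 * u a ^ (-(n / α)) := by gcongr; linarith
        _ = _ := one_mul _
    have h3 : (∫ x in a..b, u x ^ (-(n / α))) ^ α ≤ u a ^ (-n) := by
      refine (Real.rpow_le_rpow hJ hI hα.le).trans_eq ?_
      rw [← Real.rpow_mul hua.le]
      congr 1; field_simp
    have h4 : u a ^ (-n) ≤ u a ^ (-(α + 1)) :=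
      Real.rpow_le_rpow_of_exponent_ge hua hu1 (by linarith)
    rw [one_mul, one_div, Real.inv_rpow hua.le, ← Real.rpow_neg hua.le]
    calc _ ≤ (∫ x in a..b, u x ^ (-(n / α))) ^ α * 1 := by
          gcongr
          exact min_le_right _ _
      _ ≤ _ := by linarith
  · have hq1 : 0 < n / α - 1 := by rw [sub_pos, lt_div_iff₀ hα]; linarith
    refine ⟨(4 / (n / α - 1)) ^ α, by positivity, ?_⟩
    intro u u1 a b δ ha hab hb hδ hδu hu1 h1 c1 hq
    have hua : 0 < u a := hδ.trans_le hδu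
    have hmono := common u u1 a b hab hua h1 hq
    have hpos : ∀ x ∈ Icc a b, 0 < u x := fun x hx => hua.trans_le (hmono x hx)
    have cu : ContinuousOn u (Icc a b) := fun x _ => (h1 x).continuousAt.continuousWithinAt
    have cf : ContinuousOn (fun x => u x ^ (-(n / α))) (Icc a b) :=
      cu.rpow_const fun x hx => Or.inl (hpos x hx).ne'
    have hJ : 0 ≤ ∫ x in a..b, u x ^ (-(n / α)) :=
      intervalIntegral.integral_nonneg hab fun x hx => by have := hpos x hx; positivity
    have cg : ContinuousOn (fun x => 4 * (u1 x * u x ^ (-(n / α)))) (Icc a b) :=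
      continuousOn_const.mul (c1.continuousOn.mul cf)
    have hftc : (∫ x in a..b, 4 * (u1 x * u x ^ (-(n / α)))) =
        -(4 / (n / α - 1)) * u b ^ (1 - n / α) - -(4 / (n / α - 1)) * u a ^ (1 - n / α) := by
      apply intervalIntegral.integral_eq_sub_of_hasDerivAt
        (f := fun x => -(4 / (n / α - 1)) * u x ^ (1 - n / α))
      · intro x hx
        rw [uIcc_of_le hab] at hx
        have := ((h1 x).rpow_const (p := 1 - n / α) (Or.inl (hpos x hx).ne')).const_mul
          (-(4 / (n / α - 1)))
        refine this.congr_deriv ?_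
        rw [show 1 - n / α - 1 = -(n / α) by ring]
        have : -(4 / (n / α - 1)) * (1 - n / α) = 4 := by
          rw [show 1 - n / α = -(n / α - 1) by ring, neg_mul_neg, div_mul_cancel₀ _ hq1.ne']
        linear_combination (u1 x * u x ^ (-(n / α))) * this
      · exact cg.intervalIntegrable_of_Icc hab
    have hI : (∫ x in a..b, u x ^ (-(n / α))) ≤ 4 / (n / α - 1) * u a ^ (1 - n / α) := by
      calc _ ≤ ∫ x in a..b, 4 * (u1 x * u x ^ (-(n / α))) := by
            apply intervalIntegral.integral_mono_on hab (cf.intervalIntegrable_of_Icc hab)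
              (cg.intervalIntegrable_of_Icc hab)
            intro x hx
            have e := hq x hx
            have e2 : 0 ≤ u x ^ (-(n / α)) := (Real.rpow_pos_of_pos (hpos x hx) _).le
            nlinarith
        _ ≤ _ := by
            rw [hftc]
            have : 0 ≤ 4 / (n / α - 1) * u b ^ (1 - n / α) := by
              have := hpos b ⟨hab, le_rfl⟩
              positivity
            linarith
    have h3 : (∫ x in a..b, u x ^ (-(n / α))) ^ α ≤ (4 / (n / α - 1)) ^ α * u a ^ (α - n) := by
      refine (Real.rpow_le_rpow hJ hI hα.le).trans_eq ?_
      rw [Real.mul_rpow (by positivity) (by positivity), ← Real.rpow_mul hua.le]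
      congr 2; field_simp
    have h4 : min (δ ^ (n - 1 - 2 * α)) 1 ≤ u a ^ (n - 1 - 2 * α) := by
      rcases le_total 0 (n - 1 - 2 * α) with h | h
      · exact (min_le_left _ _).trans (Real.rpow_le_rpow hδ.le hδu h)
      · exact (min_le_right _ _).trans (Real.one_le_rpow_of_pos_of_le_one_of_nonpos hua hu1 h)
    rw [one_div, Real.inv_rpow hua.le, ← Real.rpow_neg hua.le]
    calc _ ≤ ((4 / (n / α - 1)) ^ α * u a ^ (α - n)) * u a ^ (n - 1 - 2 * α) := by
          gcongr
      _ = _ := by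
          rw [mul_assoc, ← Real.rpow_add hua]
          congr 2; ring

lemma core {n α : ℝ} (hn : 0 < n) (hα : 0 < α) : ∃ C : ℝ, 0 < C ∧
    ∀ (u u1 u2 u3 : ℝ → ℝ) (δ m M : ℝ), (∀ x, HasDerivAt u (u1 x) x) →
    (∀ x, HasDerivAt u1 (u2 x) x) → (∀ x, HasDerivAt u2 (u3 x) x) → Continuous u3 →
    0 < δ → δ < 1 / 2 → 0 ≤ m → m < M → M ≤ 1 → (∀ x ∈ Icc (0:ℝ) 1, δ ≤ u x) →
    u m = δ → u1 m = 0 → 1 ≤ u M → u1 1 = 0 →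
    C / Real.log (1 / δ) ^ (α + 1) * min (δ ^ (n - 1 - 2 * α)) 1
        ≤ ∫ x in (0:ℝ)..1, u x ^ n * |u3 x| ^ (α + 1) := by
  obtain ⟨K, hK, hw⟩ := weight_aux hn hα
  refine ⟨(3 / 32) ^ (α + 1) / K, by positivity, ?_⟩
  intro u u1 u2 u3 δ m M h1 h2 h3 c3 hδ hδ2 hm0 hmM hM1 hmin hum hu1m huM hu11
  have hL : 0 < Real.log (1 / δ) := Real.log_pos (by rw [lt_div_iff₀ hδ]; linarith)
  obtain ⟨a, ha, hua1, hu1a, hu2a⟩ := ham_point h1 h2 hδ hδ2 hm0 hmM hM1 hmin hum hu1m huM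
  have cu : Continuous u := continuous_iff_continuousAt.2 fun x => (h1 x).continuousAt
  have cu1 : Continuous u1 := continuous_iff_continuousAt.2 fun x => (h2 x).continuousAt
  have cu2 : Continuous u2 := continuous_iff_continuousAt.2 fun x => (h3 x).continuousAt
  set L := Real.log (1 / δ) with hLdef
  have hua := hδ.trans_le (hmin a ha)
  have hκ : 0 < 3 / (32 * L) / u a := by positivity
  have ha1 : a < 1 := by
    rcases ha.2.lt_or_eq with h | h
    · exact h
    · subst h; linarith
  obtain ⟨y, hy, hys⟩ := exists_hasDerivAt_eq_slope u1 u2 ha1 cu1.continuousOn (fun x _ => h2 x)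
  have hy2 : u2 y ≤ 0 := by
    rw [hys]
    exact div_nonpos_of_nonpos_of_nonneg (by linarith) (by linarith)
  obtain ⟨b, hb, hub, hb2⟩ := first_hit (f := fun x => -u2 x) (by fun_prop) hy.1.le
    (by linarith) (by linarith)
  have hab : a ≤ b := hb.1.le
  have hb1 : b ≤ 1 := hb.2.trans hy.2.le
  have hq : ∀ x ∈ Icc a b, 1 / 4 ≤ u1 x := by
    intro x hx
    have : MonotoneOn u1 (Icc a b) := by
      apply monotoneOn_of_deriv_nonneg (convex_Icc a b)
      · exact cu1.continuousOn
      · exact fun x _ => (h2 x).differentiableAt.differentiableWithinAt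
      · intro x hx
        rw [(h2 x).deriv]
        have := hb2 x (interior_subset hx)
        linarith
    exact hu1a.trans (this ⟨le_rfl, hab⟩ hx hx.1)
  have hpos : ∀ x ∈ Icc (0:ℝ) 1, 0 < u x := fun x hx => hδ.trans_le (hmin x hx)
  have hW := hw u u1 a b δ ha.1 hab hb1 hδ (hmin a ha) hua1 h1 cu1 hq
  have hpos' : ∀ x ∈ Icc a b, 0 < u x := fun x hx =>
    hpos x ⟨ha.1.trans hx.1, hx.2.trans hb1⟩
  have hH := holder_aux (n := n) hα hab cu.continuousOn c3.continuousOn hpos'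
  have hA : 3 / (32 * L) / u a ≤ ∫ x in a..b, |u3 x| := by
    have e : ∫ x in a..b, u3 x = u2 b - u2 a :=
      intervalIntegral.integral_eq_sub_of_hasDerivAt (fun x _ => h3 x) (c3.intervalIntegrable _ _)
    have e2 := intervalIntegral.abs_integral_le_integral_abs (f := u3) (μ := MeasureTheory.volume) hab
    rw [e] at e2
    have e3 := neg_abs_le (u2 b - u2 a)
    linarith
  have hD : (∫ x in a..b, u x ^ n * |u3 x| ^ (α + 1)) ≤
      ∫ x in (0:ℝ)..1, u x ^ n * |u3 x| ^ (α + 1) := by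
    apply intervalIntegral.integral_mono_interval ha.1 hab hb1
    · filter_upwards [MeasureTheory.ae_restrict_mem measurableSet_Ioc] with x hx
      have := hpos x (Ioc_subset_Icc_self hx)
      simp only [Pi.zero_apply]
      positivity
    · apply ContinuousOn.intervalIntegrable_of_Icc zero_le_one
      exact (cu.continuousOn.rpow_const fun x hx => Or.inl (hpos x hx).ne').mul
        (c3.abs.continuousOn.rpow_const fun x hx => Or.inr (by linarith))
  refine le_trans ?_ hD
  set D := ∫ x in a..b, u x ^ n * |u3 x| ^ (α + 1)
  set J := ∫ x in a..b, u x ^ (-(n / α)) with hJdef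
  have hJ : 0 ≤ J :=
    intervalIntegral.integral_nonneg hab fun x hx => by have := hpos' x hx; positivity
  have h5 : (3 / (32 * L) / u a) ^ (α + 1) ≤ D * J ^ α :=
    (Real.rpow_le_rpow hκ.le hA (by linarith)).trans hH
  have h6 : (3 / (32 * L) / u a) ^ (α + 1) = (3 / 32) ^ (α + 1) / L ^ (α + 1) * (1 / u a) ^ (α + 1) := by
    rw [← Real.div_rpow (by positivity) hL.le, ← Real.mul_rpow (by positivity) (by positivity)]
    congr 1
    field_simp
  have hJp : 0 < J ^ α := by
    rcases (Real.rpow_nonneg hJ α).lt_or_eq with h | h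
    · exact h
    · rw [← h, mul_zero] at h5
      have := Real.rpow_pos_of_pos hκ (α + 1)
      linarith
  set P := (3 / 32 : ℝ) ^ (α + 1) / L ^ (α + 1) with hP
  have hPpos : 0 < P := by positivity
  have h7 : P * (J ^ α * min (δ ^ (n - 1 - 2 * α)) 1) ≤ K * (D * J ^ α) := by
    calc _ ≤ P * (K * (1 / u a) ^ (α + 1)) := by gcongr
      _ = K * (3 / (32 * L) / u a) ^ (α + 1) := by rw [h6]; ring
      _ ≤ _ := by gcongr
  have h8 : P * min (δ ^ (n - 1 - 2 * α)) 1 ≤ K * D := by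
    refine le_of_mul_le_mul_right ?_ hJp
    linarith
  have : (3 / 32 : ℝ) ^ (α + 1) / K / L ^ (α + 1) * min (δ ^ (n - 1 - 2 * α)) 1 =
      P * min (δ ^ (n - 1 - 2 * α)) 1 / K := by rw [hP]; ring
  rw [this, div_le_iff₀ hK]
  linarith

theorem dissipation_lower_bound (n α : ℝ) (hn : 0 < n) (hα : 0 < α) :
    ∃ C : ℝ, 0 < C ∧ ∀ (u : ℝ → ℝ) (δ : ℝ),
      ContDiff ℝ 3 u →
      (∫ x in (0:ℝ)..1, u x) = 1 →
      0 < δ → δ < 1 / 2 →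
      (∀ x ∈ Icc (0:ℝ) 1, δ ≤ u x) →
      (∃ x ∈ Icc (0:ℝ) 1, u x = δ) →
      deriv u 0 = 0 → deriv u 1 = 0 →
      C / Real.log (1 / δ) ^ (α + 1) * min (δ ^ (n - 1 - 2 * α)) 1
        ≤ ∫ x in (0:ℝ)..1, u x ^ n * |iteratedDeriv 3 u x| ^ (α + 1) := by
  obtain ⟨C, hC, hcore⟩ := core hn hα
  refine ⟨C, hC, ?_⟩
  intro u δ hu hmean hδ hδ2 hmin ⟨m, hm, hum⟩ hu0 hu1
  have hd : ∀ k : ℕ, k < 3 → ∀ x, HasDerivAt (iteratedDeriv k u) (iteratedDeriv (k + 1) u x) x := by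
    intro k hk x
    rw [iteratedDeriv_succ]
    exact (hu.differentiable_iteratedDeriv k (by exact_mod_cast hk) x).hasDerivAt
  have h1 : ∀ x, HasDerivAt u (iteratedDeriv 1 u x) x := by
    simpa using hd 0 (by norm_num)
  have h2 : ∀ x, HasDerivAt (iteratedDeriv 1 u) (iteratedDeriv 2 u x) x := hd 1 (by norm_num)
  have h3 : ∀ x, HasDerivAt (iteratedDeriv 2 u) (iteratedDeriv 3 u x) x := hd 2 (by norm_num)
  have c3 : Continuous (iteratedDeriv 3 u) := hu.continuous_iteratedDeriv 3 le_rfl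
  rw [← iteratedDeriv_one] at hu0 hu1
  have hm1 : iteratedDeriv 1 u m = 0 := by
    rcases hm.1.lt_or_eq with h | h
    · rcases hm.2.lt_or_eq with h' | h'
      · have : IsLocalMin u m := by
          filter_upwards [Icc_mem_nhds h h'] with x hx
          rw [hum]; exact hmin x hx
        exact this.hasDerivAt_eq_zero (h1 m)
      · rw [h']; exact hu1
    · rw [← h]; exact hu0
  have cu : Continuous u := hu.continuous
  obtain ⟨M, hM, hMs⟩ := exists_hasDerivAt_eq_slope (fun x => ∫ t in (0:ℝ)..x, u t) u
    (zero_lt_one (α := ℝ))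
    (fun x _ => (cu.integral_hasStrictDerivAt 0 x).hasDerivAt.continuousAt.continuousWithinAt)
    (fun x _ => (cu.integral_hasStrictDerivAt 0 x).hasDerivAt)
  have huM : u M = 1 := by simpa [hmean] using hMs
  rcases lt_trichotomy m M with h | h | h
  · exact hcore u _ _ _ δ m M h1 h2 h3 c3 hδ hδ2 hm.1 h hM.2.le hmin hum hm1 huM.ge hu1
  · subst h; linarith
  · have hr : ∀ x : ℝ, HasDerivAt (fun y : ℝ => 1 - y) (-1) x := fun x => by
      simpa using (hasDerivAt_id x).const_sub 1
    have key := hcore (fun x => u (1 - x)) (fun x => -iteratedDeriv 1 u (1 - x))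
      (fun x => iteratedDeriv 2 u (1 - x)) (fun x => -iteratedDeriv 3 u (1 - x)) δ (1 - m) (1 - M)
      (fun x => ((h1 (1 - x)).comp x (hr x)).congr_deriv (by ring))
      (fun x => ((h2 (1 - x)).comp x (hr x)).neg.congr_deriv (by ring))
      (fun x => ((h3 (1 - x)).comp x (hr x)).congr_deriv (by ring))
      (by fun_prop) hδ hδ2 (by linarith [hm.2]) (by linarith) (by linarith [hM.1])
      (fun x hx => hmin _ ⟨by linarith [hx.2], by linarith [hx.1]⟩)
      (by simpa using hum) (by simpa using hm1) (by simpa using huM.ge) (by simpa using hu0)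
    simp only [abs_neg] at key
    rw [intervalIntegral.integral_comp_sub_left
      (fun x => u x ^ n * |iteratedDeriv 3 u x| ^ (α + 1)) 1] at key
    simpa using key
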